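/- Geometric commutation for the number operator and the annihilation operator: the QCPB satisfies [N̂, a] = −a + a∘N̂^(cg) − N̂∘b, where N̂ = a†∘a, N̂^(cg) = −(i/ω)·ŵ^(cl), and b is the multiplication operator by √(ℏ/2mω)·u; the identity holds applied to every smooth f : ℝ → ℂ. -/

import Mathlib

noncomputable section
open Complex

/-- Operators acting on functions `ℝ → ℂ`. -/
abbrev Op : Type := (ℝ → ℂ) → (ℝ → ℂ)

/-- Multiplication operator by a real-valued function. -/
def mulOp (g : ℝ → ℝ) : Op := fun f x => (g x : ℂ) * f x

/-- Quantum Poisson bracket `[A,B]_QPB = A∘B − B∘A`. -/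
def QPB (A B : Op) : Op := fun f => A (B f) - B (A f)

/-- Quantum covariant Poisson bracket
`[A,B] = [A,B]_QPB + A∘[s,B]_QPB − B∘[s,A]_QPB`. -/
def QCPB (s : ℝ → ℝ) (A B : Op) : Op :=
  fun f => QPB A B f + A (QPB (mulOp s) B f) - B (QPB (mulOp s) A f)

/-- Position (multiplication by `x`). -/
def xhat : Op := fun f x => (x : ℂ) * f x

/-- Classical momentum operator `p̂⁽ᶜˡ⁾ f = −iℏ f'`. -/
def pcl (ℏ : ℝ) : Op := fun f x => -Complex.I * (ℏ : ℂ) * deriv f x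

/-- Classical harmonic-oscillator Hamiltonian. -/
def Hcl (ℏ m ω : ℝ) : Op := fun f x =>
  -((ℏ : ℂ) ^ 2 / (2 * (m : ℂ))) * deriv (deriv f) x
    + ((m : ℂ) * (ω : ℂ) ^ 2 / 2) * (x : ℂ) ^ 2 * f x

/-- Geomentum operator `p̂⁽ʳⁱ⁾ f = −iℏ (f' + u f)` with `u = s'`. -/
def pri (ℏ : ℝ) (s : ℝ → ℝ) : Op := fun f x =>
  -Complex.I * (ℏ : ℂ) * (deriv f x + ((deriv s x : ℝ) : ℂ) * f x)

/-- Ri-operator Hamiltonian `Ĥ⁽ʳⁱ⁾ = (1/2m) p̂⁽ʳⁱ⁾∘p̂⁽ʳⁱ⁾ + (mω²/2)x²`. -/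
def Hri (ℏ m ω : ℝ) (s : ℝ → ℝ) : Op := fun f x =>
  (1 / (2 * (m : ℂ))) * pri ℏ s (pri ℏ s f) x
    + ((m : ℂ) * (ω : ℂ) ^ 2 / 2) * (x : ℂ) ^ 2 * f x

/-- G-dynamics operator `ŵ⁽ᶜˡ⁾ f = −(iℏ/2m)(2u f' + u' f)`. -/
def wcl (ℏ m : ℝ) (s : ℝ → ℝ) : Op := fun f x =>
  -(Complex.I * (ℏ : ℂ) / (2 * (m : ℂ))) *
    (2 * ((deriv s x : ℝ) : ℂ) * deriv f x + ((deriv (deriv s) x : ℝ) : ℂ) * f x)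

/-- Ri G-dynamics operator `ŵ⁽ʳⁱ⁾ f = −(iℏ/2m)(2u f' + u' f + 2u² f)`. -/
def wri (ℏ m : ℝ) (s : ℝ → ℝ) : Op := fun f x =>
  -(Complex.I * (ℏ : ℂ) / (2 * (m : ℂ))) *
    (2 * ((deriv s x : ℝ) : ℂ) * deriv f x + ((deriv (deriv s) x : ℝ) : ℂ) * f x
      + 2 * ((deriv s x : ℝ) : ℂ) ^ 2 * f x)

/-- Annihilation operator. -/
def aOp (ℏ m ω : ℝ) : Op := fun f x =>
  (Real.sqrt (m * ω / (2 * ℏ)) : ℂ) *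
    ((x : ℂ) * f x + ((ℏ : ℂ) / ((m : ℂ) * (ω : ℂ))) * deriv f x)

/-- Creation operator. -/
def adOp (ℏ m ω : ℝ) : Op := fun f x =>
  (Real.sqrt (m * ω / (2 * ℏ)) : ℂ) *
    ((x : ℂ) * f x - ((ℏ : ℂ) / ((m : ℂ) * (ω : ℂ))) * deriv f x)

/-- `b`: multiplication by `√(ℏ/2mω)·u`. -/
def bOp (ℏ m ω : ℝ) (s : ℝ → ℝ) : Op :=
  mulOp (fun x => Real.sqrt (ℏ / (2 * m * ω)) * deriv s x)

/-- Number operator `N̂ = a†∘a`. -/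
def NOp (ℏ m ω : ℝ) : Op := fun f => adOp ℏ m ω (aOp ℏ m ω f)

/-- `N̂⁽ᶜᵍ⁾ = −(i/ω)·ŵ⁽ᶜˡ⁾`. -/
def Ncg (ℏ m ω : ℝ) (s : ℝ → ℝ) : Op := fun f x =>
  -(Complex.I / (ω : ℂ)) * wcl ℏ m s f x

/-- Geometric annihilation operator `a⁽ˢ⁾ = a + b`. -/
def asOp (ℏ m ω : ℝ) (s : ℝ → ℝ) : Op := fun f x =>
  aOp ℏ m ω f x + bOp ℏ m ω s f x

/-- Geometric creation operator `a⁽ˢ⁾† = a† − b`. -/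
def adsOp (ℏ m ω : ℝ) (s : ℝ → ℝ) : Op := fun f x =>
  adOp ℏ m ω f x - bOp ℏ m ω s f x

lemma hasDerivAt_ofReal_comp {g : ℝ → ℝ} (hg : Differentiable ℝ g) (x : ℝ) :
    HasDerivAt (fun y => (g y : ℂ)) ((deriv g x : ℝ) : ℂ) x :=
  (hg x).hasDerivAt.ofReal_comp

lemma deriv_aOp (ℏ m ω : ℝ) {f : ℝ → ℂ} (hf : Differentiable ℝ f)
    (hf' : Differentiable ℝ (deriv f)) (x : ℝ) :
    deriv (aOp ℏ m ω f) x = (Real.sqrt (m * ω / (2 * ℏ)) : ℂ) *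
      (f x + (x : ℂ) * deriv f x + ((ℏ : ℂ) / ((m : ℂ) * (ω : ℂ))) * deriv (deriv f) x) := by
  have hx : HasDerivAt (fun y : ℝ => (y : ℂ)) 1 x := ofRealCLM.hasDerivAt
  refine HasDerivAt.deriv ((((hx.mul (hf x).hasDerivAt).add
    ((hf' x).hasDerivAt.const_mul ((ℏ : ℂ) / ((m : ℂ) * (ω : ℂ))))).const_mul
    (Real.sqrt (m * ω / (2 * ℏ)) : ℂ)).congr_deriv ?_)
  ring

lemma deriv_adOp (ℏ m ω : ℝ) {f : ℝ → ℂ} (hf : Differentiable ℝ f)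
    (hf' : Differentiable ℝ (deriv f)) (x : ℝ) :
    deriv (adOp ℏ m ω f) x = (Real.sqrt (m * ω / (2 * ℏ)) : ℂ) *
      (f x + (x : ℂ) * deriv f x - ((ℏ : ℂ) / ((m : ℂ) * (ω : ℂ))) * deriv (deriv f) x) := by
  have hx : HasDerivAt (fun y : ℝ => (y : ℂ)) 1 x := ofRealCLM.hasDerivAt
  refine HasDerivAt.deriv ((((hx.mul (hf x).hasDerivAt).sub
    ((hf' x).hasDerivAt.const_mul ((ℏ : ℂ) / ((m : ℂ) * (ω : ℂ))))).const_mul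
    (Real.sqrt (m * ω / (2 * ℏ)) : ℂ)).congr_deriv ?_)
  ring

lemma deriv_mulOp {g : ℝ → ℝ} {f : ℝ → ℂ} (hg : Differentiable ℝ g)
    (hf : Differentiable ℝ f) :
    deriv (mulOp g f) = fun x => ((deriv g x : ℝ) : ℂ) * f x + (g x : ℂ) * deriv f x :=
  funext fun x => ((hasDerivAt_ofReal_comp hg x).mul (hf x).hasDerivAt).deriv

lemma ContDiff.differentiable_deriv_of_smooth {E : Type*} [NormedAddCommGroup E]
    [NormedSpace ℝ E] {f : ℝ → E} (hf : ContDiff ℝ (⊤ : ℕ∞) f) :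
    Differentiable ℝ (deriv f) :=
  (contDiff_infty_iff_deriv.1 hf).2.differentiable (by simp)

lemma contDiff_aOp (ℏ m ω : ℝ) {f : ℝ → ℂ} (hf : ContDiff ℝ (⊤ : ℕ∞) f) :
    ContDiff ℝ (⊤ : ℕ∞) (aOp ℏ m ω f) :=
  contDiff_const.mul ((ofRealCLM.contDiff.mul hf).add
    (contDiff_const.mul (contDiff_infty_iff_deriv.1 hf).2))

lemma contDiff_mulOp {g : ℝ → ℝ} {f : ℝ → ℂ} (hg : ContDiff ℝ (⊤ : ℕ∞) g)
    (hf : ContDiff ℝ (⊤ : ℕ∞) f) : ContDiff ℝ (⊤ : ℕ∞) (mulOp g f) :=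
  (ofRealCLM.contDiff.comp hg).mul hf

lemma aOp_neg (ℏ m ω : ℝ) (f : ℝ → ℂ) : aOp ℏ m ω (-f) = -aOp ℏ m ω f := by
  funext x
  simp only [aOp, Pi.neg_apply, deriv.neg]
  ring

lemma adOp_neg (ℏ m ω : ℝ) (f : ℝ → ℂ) : adOp ℏ m ω (-f) = -adOp ℏ m ω f := by
  funext x
  simp only [adOp, Pi.neg_apply, deriv.neg]
  ring

lemma NOp_neg (ℏ m ω : ℝ) (f : ℝ → ℂ) : NOp ℏ m ω (-f) = -NOp ℏ m ω f := by
  simp only [NOp, aOp_neg, adOp_neg]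

lemma ofReal_sqrt_sq {r : ℝ} (hr : 0 ≤ r) : (Real.sqrt r : ℂ) ^ 2 = r := by
  rw [← ofReal_pow, Real.sq_sqrt hr]

lemma sqrt_mul_div_eq {ℏ m ω : ℝ} (hℏ : 0 < ℏ) (hm : 0 < m) (hω : 0 < ω) :
    Real.sqrt (m * ω / (2 * ℏ)) * (ℏ / (m * ω)) = Real.sqrt (ℏ / (2 * m * ω)) := by
  rw [eq_comm, Real.sqrt_eq_iff_mul_self_eq (by positivity) (by positivity),
    mul_mul_mul_comm, Real.mul_self_sqrt (by positivity)]
  field_simp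

/-- The canonical commutation relation `[a, a†] = 1`. -/
lemma QPB_aOp_adOp {ℏ m ω : ℝ} (hℏ : 0 < ℏ) (hm : 0 < m) (hω : 0 < ω) {f : ℝ → ℂ}
    (hf : Differentiable ℝ f) (hf' : Differentiable ℝ (deriv f)) :
    QPB (aOp ℏ m ω) (adOp ℏ m ω) f = f := by
  funext x
  change aOp ℏ m ω (adOp ℏ m ω f) x - adOp ℏ m ω (aOp ℏ m ω f) x = f x
  rw [aOp, adOp, deriv_adOp ℏ m ω hf hf', adOp, deriv_aOp ℏ m ω hf hf', aOp]
  have hk := ofReal_sqrt_sq (r := m * ω / (2 * ℏ)) (by positivity)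
  have hc : (m * ω / (2 * ℏ) : ℂ) * (ℏ / (m * ω)) = 1 / 2 := by
    have := ofReal_ne_zero.2 hℏ.ne'
    have := ofReal_ne_zero.2 hm.ne'
    have := ofReal_ne_zero.2 hω.ne'
    field_simp
  push_cast at hk
  linear_combination 2 * (ℏ / (m * ω) : ℂ) * f x * hk + 2 * f x * hc

lemma QPB_mulOp_aOp {ℏ m ω : ℝ} (hℏ : 0 < ℏ) (hm : 0 < m) (hω : 0 < ω) {s : ℝ → ℝ}
    {f : ℝ → ℂ} (hs : Differentiable ℝ s) (hf : Differentiable ℝ f) :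
    QPB (mulOp s) (aOp ℏ m ω) f = -bOp ℏ m ω s f := by
  funext x
  change mulOp s (aOp ℏ m ω f) x - aOp ℏ m ω (mulOp s f) x = -bOp ℏ m ω s f x
  simp only [aOp, deriv_mulOp hs hf, bOp, mulOp, ← sqrt_mul_div_eq hℏ hm hω]
  push_cast
  ring

lemma NOp_apply {ℏ m ω : ℝ} {f : ℝ → ℂ} (hf : Differentiable ℝ f)
    (hf' : Differentiable ℝ (deriv f)) (x : ℝ) :
    NOp ℏ m ω f x = (Real.sqrt (m * ω / (2 * ℏ)) : ℂ) ^ 2 *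
      ((x : ℂ) ^ 2 * f x - (ℏ / (m * ω) : ℂ) * f x
        - (ℏ / (m * ω) : ℂ) ^ 2 * deriv (deriv f) x) := by
  rw [NOp, adOp, deriv_aOp ℏ m ω hf hf', aOp]
  ring

lemma QPB_mulOp_NOp {ℏ m ω : ℝ} (hℏ : 0 < ℏ) (hm : 0 < m) (hω : 0 < ω) {s : ℝ → ℝ}
    {f : ℝ → ℂ} (hs : ContDiff ℝ (⊤ : ℕ∞) s) (hf : ContDiff ℝ (⊤ : ℕ∞) f) :
    QPB (mulOp s) (NOp ℏ m ω) f = -Ncg ℏ m ω s f := by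
  have ds := hs.differentiable (by simp)
  have df := hf.differentiable (by simp)
  have ds' := hs.differentiable_deriv_of_smooth
  have df' := hf.differentiable_deriv_of_smooth
  have hsf := contDiff_mulOp hs hf
  funext x
  change mulOp s (NOp ℏ m ω f) x - NOp ℏ m ω (mulOp s f) x = -Ncg ℏ m ω s f x
  have hdd : deriv (deriv (mulOp s f)) x = ((deriv (deriv s) x : ℝ) : ℂ) * f x
      + 2 * ((deriv s x : ℝ) : ℂ) * deriv f x + (s x : ℂ) * deriv (deriv f) x := by
    rw [deriv_mulOp ds df]
    refine HasDerivAt.deriv ((((hasDerivAt_ofReal_comp ds' x).mul (df x).hasDerivAt).add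
      ((hasDerivAt_ofReal_comp ds x).mul (df' x).hasDerivAt)).congr_deriv ?_)
    ring
  rw [NOp_apply (hsf.differentiable (by simp)) hsf.differentiable_deriv_of_smooth, hdd,
    mulOp, NOp_apply df df', mulOp, Ncg, wcl, ofReal_sqrt_sq (by positivity)]
  have := ofReal_ne_zero.2 hℏ.ne'
  have := ofReal_ne_zero.2 hm.ne'
  have := ofReal_ne_zero.2 hω.ne'
  push_cast
  field_simp
  rw [I_sq]
  ring

lemma QPB_NOp_aOp {ℏ m ω : ℝ} (hℏ : 0 < ℏ) (hm : 0 < m) (hω : 0 < ω) {f : ℝ → ℂ}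
    (hf : ContDiff ℝ (⊤ : ℕ∞) f) :
    QPB (NOp ℏ m ω) (aOp ℏ m ω) f = -aOp ℏ m ω f := by
  have ha := contDiff_aOp ℏ m ω hf
  rw [← neg_eq_iff_eq_neg, QPB, neg_sub]
  exact QPB_aOp_adOp hℏ hm hω (ha.differentiable (by simp)) ha.differentiable_deriv_of_smooth

/-- Geometric commutation for the number and annihilation operators:
`[N̂, a] = −a + a∘N̂⁽ᶜᵍ⁾ − N̂∘b`. -/
theorem geometric_commutation_number_annihilation (ℏ m ω : ℝ)
    (hℏ : 0 < ℏ) (hm : 0 < m) (hω : 0 < ω)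
    (s : ℝ → ℝ) (hs : ContDiff ℝ (⊤ : ℕ∞) s) :
    ∀ f : ℝ → ℂ, ContDiff ℝ (⊤ : ℕ∞) f → ∀ x : ℝ,
      QCPB s (NOp ℏ m ω) (aOp ℏ m ω) f x
        = -(aOp ℏ m ω f x) + aOp ℏ m ω (Ncg ℏ m ω s f) x
          - NOp ℏ m ω (bOp ℏ m ω s f) x := by
  intro f hf x
  rw [QCPB, QPB_NOp_aOp hℏ hm hω hf, QPB_mulOp_NOp hℏ hm hω hs hf,
    QPB_mulOp_aOp hℏ hm hω (hs.differentiable (by simp)) (hf.differentiable (by simp)),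
    NOp_neg, aOp_neg]
  simp only [Pi.add_apply, Pi.sub_apply, Pi.neg_apply]
  ring
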